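/- Let α ∈ (1,2), τ > 0, and p > 0. For s > 0 and ξ ∈ ℂ with Re ξ > 0, define f_s(ξ) = ∫_0^∞ J_τ(r) r^{p−1} e^{−s r^α ξ} dr, where J_τ is the Bessel function of the first kind of order τ. Then, as s → 0+, f_s(ξ) → 2^{p−1} Γ((τ+p)/2) / Γ(1 + (τ−p)/2), uniformly in ξ on every compact subset of {z ∈ ℂ : Re z > 0}. -/

import Mathlib

open MeasureTheory Real Filter Topology
open scoped RealInnerProductSpace ENNReal NNReal

noncomputable section

namespace StablePaper

abbrev Ed (d : ℕ) : Type := EuclideanSpace ℝ (Fin d)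

abbrev Sph (d : ℕ) := Metric.sphere (0 : Ed d) 1

/-- The surface measure `ω` on the unit sphere `S^{d-1}`. -/
def ωd (d : ℕ) : Measure (Sph d) := (volume : Measure (Ed d)).toSphere

/-- `u_z = z/|z|` for `z ≠ 0`, as a point of the unit sphere. -/
def unitize {d : ℕ} (z : Ed d) (hz : z ≠ 0) : Sph d :=
  ⟨‖z‖⁻¹ • z, by
    rw [mem_sphere_iff_norm, sub_zero, norm_smul, norm_inv, norm_norm,
      inv_mul_cancel₀ (norm_ne_zero_iff.mpr hz)]⟩

/-- Negation on the unit sphere. -/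
def negS {d : ℕ} (u : Sph d) : Sph d :=
  ⟨-(u : Ed d), by
    rw [mem_sphere_iff_norm, sub_zero, norm_neg]
    have := u.2
    rwa [mem_sphere_iff_norm, sub_zero] at this⟩

/-- Rising factorial (Pochhammer symbol) `(b)_n`. -/
def risingFactorial (b : ℝ) (n : ℕ) : ℝ := ∏ i ∈ Finset.range n, (b + i)

/-- The Gegenbauer polynomial `C_j^b(t)` (for `b > 0`), via its explicit sum formula. -/
def gegenbauer (b : ℝ) (j : ℕ) (t : ℝ) : ℝ :=
  ∑ m ∈ Finset.range (j / 2 + 1),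
    (-1 : ℝ) ^ m * 2 ^ (j - 2 * m) * risingFactorial b (j - m) /
      ((Nat.factorial m : ℝ) * (Nat.factorial (j - 2 * m) : ℝ)) * t ^ (j - 2 * m)

/-- The normalized (ultraspherical) polynomial `C̃_j^b(t) = C_j^b(t)/C_j^b(1)`;
for `b = 0` it is the Chebyshev polynomial `T_j`. -/
def gegenbauerN (b : ℝ) (j : ℕ) (t : ℝ) : ℝ :=
  if b = 0 then (Polynomial.Chebyshev.T ℝ (j : ℤ)).eval t
  else gegenbauer b j t / gegenbauer b j 1

/-- `c_{j,d} = dim ℋ_{j,d}`. -/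
def cdim (d j : ℕ) : ℕ :=
  if j = 0 then 1 else Nat.choose (j + d - 2) j + Nat.choose (j + d - 3) (j - 1)

/-- The surface area `A(S^{d-1}) = 2 π^{d/2} / Γ(d/2)`. -/
def sphereArea (d : ℕ) : ℝ := 2 * Real.pi ^ ((d : ℝ) / 2) / Real.Gamma ((d : ℝ) / 2)

/-- Projection onto spherical harmonics of degree `j` (real-valued version):
`(proj_j f)(u) = (c_{j,d}/A(S^{d-1})) ∫ C̃_j^{(d-2)/2}(⟨u,v⟩) f(v) ω(dv)`. -/
def projR (d j : ℕ) (f : Sph d → ℝ) (u : Sph d) : ℝ :=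
  (cdim d j : ℝ) / sphereArea d *
    ∫ v, gegenbauerN (((d : ℝ) - 2) / 2) j ⟪(u : Ed d), (v : Ed d)⟫ * f v ∂(ωd d)

/-- Projection onto spherical harmonics of degree `j` (complex-valued version). -/
def projC (d j : ℕ) (f : Sph d → ℂ) (u : Sph d) : ℂ :=
  ((cdim d j : ℂ) / (sphereArea d : ℂ)) *
    ∫ v, (gegenbauerN (((d : ℝ) - 2) / 2) j ⟪(u : Ed d), (v : Ed d)⟫ : ℂ) * f v ∂(ωd d)

/-- The coefficients `w_j(α)`. -/
def w (d : ℕ) (α : ℝ) (j : ℕ) : ℝ :=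
  Real.pi ^ ((d : ℝ) / 2) * Real.Gamma (α + 1) /
    (2 ^ (α - 1) * Real.Gamma (((j : ℝ) + α + d) / 2) * Real.Gamma ((α - j) / 2 + 1))

/-- The characteristic exponent of an `α`-stable distribution (`α ≠ 1`) with
spectral spherical measure `Λ`. -/
def charExp (d : ℕ) (α : ℝ) (Λ : Measure (Sph d)) (z : Ed d) : ℂ :=
  ∫ v, (|⟪z, (v : Ed d)⟫| ^ α : ℝ) *
      (1 - Complex.I * (Real.tan (Real.pi * α / 2) : ℂ) *
        (Real.sign ⟪z, (v : Ed d)⟫ : ℂ)) ∂Λ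

/-- `V(u)`, so that `Φ_μ(z) = |z|^α V(u_z)`. -/
def Vfun (d : ℕ) (α : ℝ) (Λ : Measure (Sph d)) (u : Sph d) : ℂ :=
  charExp d α Λ (u : Ed d)

/-- The characteristic exponent of a `1`-stable distribution with
spectral spherical measure `Λ`. -/
def charExp1 (d : ℕ) (Λ : Measure (Sph d)) (z : Ed d) : ℂ :=
  ∫ v, ((|⟪z, (v : Ed d)⟫| : ℝ) : ℂ) +
      Complex.I * ((2 / Real.pi * (⟪z, (v : Ed d)⟫ *
        Real.log |⟪z, (v : Ed d)⟫|) : ℝ) : ℂ) ∂Λ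

/-- The spectral spherical measure `λ(dv) = P(v) ω(dv)`. -/
def specMeasure (d : ℕ) (P : Sph d → ℝ) : Measure (Sph d) :=
  (ωd d).withDensity (fun v => ENNReal.ofReal (P v))

/-- `μ` has Fourier transform `exp (-Φ)` where `Φ` is the `α`-stable characteristic
exponent with spectral spherical measure `Λ` (case `α ≠ 1`). -/
def IsStableChar (d : ℕ) (α : ℝ) (Λ : Measure (Sph d)) (μ : Measure (Ed d)) : Prop :=
  ∀ z : Ed d, ∫ x, Complex.exp (Complex.I * (⟪z, x⟫ : ℂ)) ∂μ =
    Complex.exp (- charExp d α Λ z)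

/-- `μ` has Fourier transform `exp (-Φ)` where `Φ` is the `1`-stable characteristic
exponent with spectral spherical measure `Λ`. -/
def IsStableChar1 (d : ℕ) (Λ : Measure (Sph d)) (μ : Measure (Ed d)) : Prop :=
  ∀ z : Ed d, ∫ x, Complex.exp (Complex.I * (⟪z, x⟫ : ℂ)) ∂μ =
    Complex.exp (- charExp1 d Λ z)

/-- `μ` is nondegenerate: its support is not contained in any proper affine subspace. -/
def Nondegenerate (d : ℕ) (μ : Measure (Ed d)) : Prop :=
  ∀ (a : Ed d) (W : Submodule ℝ (Ed d)), W ≠ ⊤ →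
    μ ((fun x => a + x) '' (W : Set (Ed d))) < 1

/-- `P` is the restriction to the sphere of a polynomial on `ℝ^d`. -/
def IsPolyRestriction (d : ℕ) (P : Sph d → ℝ) : Prop :=
  ∃ p : MvPolynomial (Fin d) ℝ,
    ∀ u : Sph d, P u = MvPolynomial.eval (fun i => (u : Ed d) i) p

/-- `P` is the restriction to the sphere of a polynomial of degree at most `q`. -/
def IsPolyRestrictionDeg (d q : ℕ) (P : Sph d → ℝ) : Prop :=
  ∃ p : MvPolynomial (Fin d) ℝ, p.totalDegree ≤ q ∧
    ∀ u : Sph d, P u = MvPolynomial.eval (fun i => (u : Ed d) i) p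

/-- `f` is a spherical harmonic of degree `j`: the restriction to the sphere of a
homogeneous harmonic polynomial of degree `j`. -/
def IsSphericalHarmonicC (d j : ℕ) (f : Sph d → ℂ) : Prop :=
  ∃ p : MvPolynomial (Fin d) ℂ, p.IsHomogeneous j ∧
    (∑ i : Fin d, MvPolynomial.pderiv i (MvPolynomial.pderiv i p)) = 0 ∧
    ∀ u : Sph d, f u = MvPolynomial.eval (fun i => ((u : Ed d) i : ℂ)) p

/-- `S_{j,k} = (-i)^j proj_j (V^k)`. -/
def SHk (d : ℕ) (α : ℝ) (Λ : Measure (Sph d)) (j k : ℕ) (u : Sph d) : ℂ :=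
  (-Complex.I) ^ j * projC d j (fun v => (Vfun d α Λ v) ^ k) u

/-- `S_{j,p} = (-i)^j proj_j (V^p)` for real exponents `p` (principal branch). -/
def SHp (d : ℕ) (α : ℝ) (Λ : Measure (Sph d)) (j : ℕ) (p : ℝ) (u : Sph d) : ℂ :=
  (-Complex.I) ^ j * projC d j (fun v => (Vfun d α Λ v) ^ (p : ℂ)) u

/-- `g` is the density of the stable distribution with characteristic exponent
`charExp d α Λ`, given by the Fourier inversion formula. -/
def IsDensityOf (d : ℕ) (α : ℝ) (Λ : Measure (Sph d)) (g : Ed d → ℝ) : Prop :=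
  ∀ x : Ed d, (g x : ℂ) =
    (((2 * Real.pi) ^ d)⁻¹ : ℝ) *
      ∫ z : Ed d, Complex.exp (-(Complex.I * (⟪x, z⟫ : ℂ))) *
        Complex.exp (- charExp d α Λ z)

/-- Harmonic numbers `s_n`. -/
def harmonicNum (n : ℕ) : ℝ := ∑ i ∈ Finset.range n, (1 : ℝ) / (i + 1)

def betaD (d : ℕ) : ℝ :=
  if Even d then 1 - Real.log 2 - harmonicNum (d / 2) / 2
  else 1 - harmonicNum (d + 1) + harmonicNum ((d + 1) / 2) / 2

/-- The coefficients `w*_j` (for odd `j`). -/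
def wstar (d j : ℕ) : ℝ :=
  if j = 1 then Real.pi ^ ((d : ℝ) / 2) * betaD d / Real.Gamma ((d : ℝ) / 2 + 1)
  else (-1 : ℝ) ^ ((j - 3) / 2) * Real.pi ^ ((d : ℝ) / 2) *
      Real.Gamma (((j : ℝ) - 1) / 2) / (2 * Real.Gamma (((d : ℝ) + 1 + j) / 2))

/-- The Bessel function of the first kind `J_τ`. -/
def besselJ (τ : ℝ) (x : ℝ) : ℝ :=
  ∑' k : ℕ, (-1 : ℝ) ^ k * (x / 2) ^ (2 * (k : ℝ) + τ) /
    ((Nat.factorial k : ℝ) * Real.Gamma ((k : ℝ) + τ + 1))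

/-- The `(j,k)`-term `((-2^α)^k π^{-d/2} / (k! ρ^{kα+d})) (Γ((j+kα+d)/2)/Γ((j-kα)/2)) S_{j,k}(u)`
of the spherical-harmonic series for the density (`α ∈ (0,1)`), at radius `ρ`. -/
def phiTerm (d : ℕ) (α : ℝ) (Λ : Measure (Sph d)) (j k : ℕ) (ρ : ℝ) (u : Sph d) : ℂ :=
  ((((-((2 : ℝ) ^ α)) ^ k * Real.pi ^ (-(d : ℝ) / 2) /
      ((Nat.factorial k : ℝ) * ρ ^ ((k : ℝ) * α + d)) *
      (Real.Gamma (((j : ℝ) + k * α + d) / 2) /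
        Real.Gamma (((j : ℝ) - k * α) / 2))) : ℝ) : ℂ) * SHk d α Λ j k u

/-- The `k`-th term `((-2^α)^k π^{-d/2} / (k! r^{kα+1})) (Γ((kα+d)/2)/Γ(-kα/2)) ∫ V^k dω`
of the series for the density of `|X|`. -/
def radTerm (d : ℕ) (α : ℝ) (Λ : Measure (Sph d)) (k : ℕ) (r : ℝ) : ℂ :=
  ((((-((2 : ℝ) ^ α)) ^ k * Real.pi ^ (-(d : ℝ) / 2) /
      ((Nat.factorial k : ℝ) * r ^ ((k : ℝ) * α + 1)) *
      (Real.Gamma (((k : ℝ) * α + d) / 2) / Real.Gamma (-((k : ℝ) * α) / 2))) : ℝ) : ℂ) *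
    ∫ u, (Vfun d α Λ u) ^ k ∂(ωd d)

end StablePaper

namespace StablePaper

/-- The entire function `A_τ` with `J_τ(r) = (r/2)^τ A_τ((r/2)^2)` for `r > 0`. -/
def besselAux (τ y : ℝ) : ℝ :=
  ∑' k : ℕ, (-1 : ℝ) ^ k / ((Nat.factorial k : ℝ) * Real.Gamma ((k : ℝ) + τ + 1)) * y ^ k

theorem Gamma_add_one_le_Gamma_natCast_add {τ : ℝ} (hτ : 0 ≤ τ) (k : ℕ) :
    Real.Gamma (τ + 1) ≤ Real.Gamma ((k : ℝ) + τ + 1) := by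
  induction k with
  | zero => simp
  | succ k ih =>
    have h0 : 0 < Real.Gamma ((k : ℝ) + τ + 1) := Real.Gamma_pos_of_pos (by positivity)
    have h : Real.Gamma (((k + 1 : ℕ) : ℝ) + τ + 1)
        = ((k : ℝ) + τ + 1) * Real.Gamma ((k : ℝ) + τ + 1) := by
      rw [← Real.Gamma_add_one (by positivity)]
      push_cast
      ring_nf
    rw [h]
    have : (0 : ℝ) ≤ k := k.cast_nonneg
    nlinarith

theorem abs_besselAux_coeff_le {τ : ℝ} (hτ : 0 ≤ τ) (k : ℕ) :
    |(-1 : ℝ) ^ k / ((Nat.factorial k : ℝ) * Real.Gamma ((k : ℝ) + τ + 1))| ≤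
      (Real.Gamma (τ + 1))⁻¹ * ((Nat.factorial k : ℝ))⁻¹ := by
  have h0 : 0 < Real.Gamma (τ + 1) := Real.Gamma_pos_of_pos (by positivity)
  have h1 := Gamma_add_one_le_Gamma_natCast_add hτ k
  have h2 : (0 : ℝ) < Nat.factorial k := by positivity
  rw [abs_div, abs_pow, abs_neg, abs_one, one_pow, abs_of_pos (mul_pos h2 (h0.trans_le h1)),
    ← mul_inv, one_div, mul_comm (Real.Gamma (τ + 1))]
  gcongr

theorem summable_besselAux {τ : ℝ} (hτ : 0 ≤ τ) (y : ℝ) :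
    Summable fun k : ℕ =>
      (-1 : ℝ) ^ k / ((Nat.factorial k : ℝ) * Real.Gamma ((k : ℝ) + τ + 1)) * y ^ k := by
  refine Summable.of_norm_bounded
    ((Real.summable_pow_div_factorial |y|).mul_left (Real.Gamma (τ + 1))⁻¹) fun k => ?_
  rw [norm_mul, norm_pow, Real.norm_eq_abs, Real.norm_eq_abs]
  calc _ ≤ (Real.Gamma (τ + 1))⁻¹ * ((Nat.factorial k : ℝ))⁻¹ * |y| ^ k := by
        gcongr
        exact abs_besselAux_coeff_le hτ k
    _ = _ := by ring

theorem hasDerivAt_besselAux {τ : ℝ} (hτ : 0 ≤ τ) (y : ℝ) :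
    HasDerivAt (besselAux τ) (-besselAux (τ + 1) y) y := by
  set c : ℕ → ℝ := fun k =>
    (-1 : ℝ) ^ k / ((Nat.factorial k : ℝ) * Real.Gamma ((k : ℝ) + τ + 1)) with hc
  set R : ℝ := |y| + 1
  set u : ℕ → ℝ := fun k => (Real.Gamma (τ + 1))⁻¹ * ((k : ℝ) * R ^ (k - 1) / Nat.factorial k)
  have hu : Summable u := by
    apply Summable.mul_left
    rw [← summable_nat_add_iff 1]
    refine (Real.summable_pow_div_factorial R).congr fun k => ?_
    rw [Nat.factorial_succ]
    push_cast
    field_simp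
  have hR : 0 ≤ R := by positivity
  have key := hasDerivAt_tsum_of_isPreconnected (g := fun k y => c k * y ^ k)
    (g' := fun k y => c k * ((k : ℝ) * y ^ (k - 1))) (t := Metric.ball (0 : ℝ) R) (y₀ := 0) (y := y)
    hu Metric.isOpen_ball (convex_ball _ _).isPreconnected
    (fun k x _ => (hasDerivAt_pow k x).const_mul (c k)) ?_
    (Metric.mem_ball_self (by positivity)) (summable_besselAux hτ 0)
    (by simp [R])
  · have hs : ∑' k : ℕ, c k * ((k : ℝ) * y ^ (k - 1)) = -besselAux (τ + 1) y := by
      have hsum : Summable fun k : ℕ => c k * ((k : ℝ) * y ^ (k - 1)) := by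
        rw [← summable_nat_add_iff 1]
        refine (summable_besselAux (by positivity : 0 ≤ τ + 1) y).neg.congr fun k => ?_
        simp only [hc, Nat.factorial_succ, Nat.add_sub_cancel]
        push_cast
        rw [show (k : ℝ) + (τ + 1) + 1 = (k : ℝ) + 1 + τ + 1 by ring, pow_succ]
        field_simp
      rw [hsum.tsum_eq_zero_add, besselAux, ← tsum_neg]
      simp only [CharP.cast_eq_zero, zero_mul, mul_zero, zero_add]
      refine tsum_congr fun k => ?_
      simp only [hc, Nat.factorial_succ, Nat.add_sub_cancel]
      push_cast
      rw [show (k : ℝ) + (τ + 1) + 1 = (k : ℝ) + 1 + τ + 1 by ring, pow_succ]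
      field_simp
    rw [← hs]
    exact key
  · intro k x hx
    have hx' : |x| ≤ R := by
      rw [mem_ball_zero_iff] at hx
      exact hx.le
    rw [norm_mul, norm_mul, norm_pow, Real.norm_eq_abs, Real.norm_eq_abs, Real.norm_eq_abs,
      Nat.abs_cast]
    calc _ ≤ (Real.Gamma (τ + 1))⁻¹ * ((Nat.factorial k : ℝ))⁻¹ * (k * R ^ (k - 1)) := by
          gcongr
          exact abs_besselAux_coeff_le hτ k
      _ = _ := by simp only [u]; ring

theorem besselAux_recurrence {τ : ℝ} (hτ : 0 ≤ τ) (y : ℝ) :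
    besselAux τ y = (τ + 1) * besselAux (τ + 1) y - y * besselAux (τ + 2) y := by
  have h1 := summable_besselAux (by positivity : 0 ≤ τ + 1) y
  have h2 := summable_besselAux (by positivity : 0 ≤ τ + 2) y
  have hG : ∀ k : ℕ, Real.Gamma ((k : ℝ) + τ + 1 + 1)
      = ((k : ℝ) + τ + 1) * Real.Gamma ((k : ℝ) + τ + 1) :=
    fun k => Real.Gamma_add_one (by positivity)
  have hG0 : ∀ k : ℕ, Real.Gamma ((k : ℝ) + τ + 1) ≠ 0 :=
    fun k => (Real.Gamma_pos_of_pos (by positivity)).ne'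
  unfold besselAux
  rw [(summable_besselAux hτ y).tsum_eq_zero_add, h1.tsum_eq_zero_add, mul_add, ← tsum_mul_left,
    ← tsum_mul_left, add_sub_assoc, ← Summable.tsum_sub
      (((summable_nat_add_iff 1).2 h1).mul_left _) (h2.mul_left _)]
  congr 1
  · have := hG 0
    have h0 := hG0 0
    simp only [CharP.cast_eq_zero, zero_add] at this h0
    have h3 : τ + 1 ≠ 0 := by positivity
    simp [this]
    field_simp
  · refine tsum_congr fun k => ?_
    have e1 := hG (k + 1)
    have e0 := hG0 (k + 1)
    rw [Nat.factorial_succ]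
    push_cast at e1 e0 ⊢
    rw [show (k : ℝ) + 1 + (τ + 1) + 1 = (k : ℝ) + 1 + τ + 1 + 1 by ring,
      show (k : ℝ) + (τ + 2) + 1 = (k : ℝ) + 1 + τ + 1 + 1 by ring, e1]
    have : (k : ℝ) + 1 + τ + 1 ≠ 0 := by positivity
    field_simp
    ring

theorem besselJ_eq (τ : ℝ) {r : ℝ} (hr : 0 < r) :
    besselJ τ r = (r / 2) ^ τ * besselAux τ ((r / 2) ^ 2) := by
  rw [besselJ, besselAux, ← tsum_mul_left]
  refine tsum_congr fun k => ?_
  rw [Real.rpow_add (by positivity), ← pow_mul]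
  rw [show (r / 2) ^ (2 * (k : ℝ)) = (r / 2) ^ (2 * k) by
    rw [← Real.rpow_natCast]; push_cast; rfl]
  ring

theorem hasDerivAt_besselJ {τ : ℝ} (hτ : 0 ≤ τ) {r : ℝ} (hr : 0 < r) :
    HasDerivAt (besselJ τ) (τ / r * besselJ τ r - besselJ (τ + 1) r) r := by
  have h2 : HasDerivAt (fun r : ℝ => r / 2) (1 / 2) r := (hasDerivAt_id r).div_const 2
  have h1 : HasDerivAt (fun r : ℝ => (r / 2) ^ τ) (1 / 2 * τ * (r / 2) ^ (τ - 1)) r :=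
    h2.rpow_const (Or.inl (by positivity))
  have h3 := (hasDerivAt_besselAux hτ ((r / 2) ^ 2)).comp r (h2.pow 2)
  have h4 := h1.mul h3
  have h5 : HasDerivAt (besselJ τ) _ r := h4.congr_of_eventuallyEq (by
    filter_upwards [lt_mem_nhds hr] with x hx
    simp [besselJ_eq τ hx])
  convert h5 using 1
  rw [besselJ_eq τ hr, besselJ_eq (τ + 1) hr, Real.rpow_add (by positivity),
    Real.rpow_sub (by positivity), Real.rpow_one]
  simp
  field_simp
  ring

theorem besselJ_recurrence {τ : ℝ} (hτ : 0 ≤ τ) {r : ℝ} (hr : 0 < r) :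
    besselJ (τ + 2) r = 2 * (τ + 1) / r * besselJ (τ + 1) r - besselJ τ r := by
  rw [besselJ_eq τ hr, besselJ_eq (τ + 1) hr, besselJ_eq (τ + 2) hr, besselAux_recurrence hτ,
    Real.rpow_add (by positivity), Real.rpow_add (by positivity), Real.rpow_one, Real.rpow_two]
  field_simp
  ring

theorem hasDerivAt_besselJ_add_one {τ : ℝ} (hτ : 0 ≤ τ) {r : ℝ} (hr : 0 < r) :
    HasDerivAt (besselJ (τ + 1)) (besselJ τ r - (τ + 1) / r * besselJ (τ + 1) r) r := by
  convert hasDerivAt_besselJ (by positivity : 0 ≤ τ + 1) hr using 1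
  rw [show τ + 1 + 1 = τ + 2 by ring, besselJ_recurrence hτ hr]
  ring

theorem continuousOn_besselJ {τ : ℝ} (hτ : 0 ≤ τ) : ContinuousOn (besselJ τ) (Set.Ioi 0) :=
  fun _ hr => (hasDerivAt_besselJ hτ hr).continuousAt.continuousWithinAt

/-- On `[2τ, ∞)` the energy `(J_τ² + J_{τ+1}²) / r² - 2τ J_τ J_{τ+1} / r³` is nonincreasing. -/
theorem antitoneOn_besselJ_energy {τ : ℝ} (hτ : 0 ≤ τ) {R : ℝ} (hR : 0 < R) (hRτ : 2 * τ ≤ R) :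
    AntitoneOn (fun r => (besselJ τ r ^ 2 + besselJ (τ + 1) r ^ 2) / r ^ 2 -
      2 * τ * besselJ τ r * besselJ (τ + 1) r / r ^ 3) (Set.Ici R) := by
  have hd : ∀ r, 0 < r → HasDerivAt (fun r => (besselJ τ r ^ 2 + besselJ (τ + 1) r ^ 2) / r ^ 2 -
      2 * τ * besselJ τ r * besselJ (τ + 1) r / r ^ 3)
      (2 * (4 * τ * besselJ τ r * besselJ (τ + 1) r - r * besselJ τ r ^ 2
        - 2 * r * besselJ (τ + 1) r ^ 2) / r ^ 4) r := by
    intro r hr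
    have hu := hasDerivAt_besselJ hτ hr
    have hv := hasDerivAt_besselJ_add_one hτ hr
    have h := (((hu.pow 2).add (hv.pow 2)).div (hasDerivAt_pow 2 r) (by positivity)).sub
      (((hu.const_mul (2 * τ)).mul hv).div (hasDerivAt_pow 3 r) (by positivity))
    refine (h.congr_deriv ?_)
    simp
    field_simp
    ring
  refine antitoneOn_of_deriv_nonpos (convex_Ici R)
    (fun r hr => (hd r (hR.trans_le hr)).continuousAt.continuousWithinAt)
    (fun r hr => (hd r (hR.trans (by simpa using hr))).differentiableAt.differentiableWithinAt)
    fun r hr => ?_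
  have hr' : R < r := by simpa using hr
  have hr0 : 0 < r := hR.trans hr'
  rw [(hd r hr0).deriv]
  refine div_nonpos_of_nonpos_of_nonneg ?_ (by positivity)
  nlinarith [mul_nonneg hτ (sq_nonneg (besselJ τ r - besselJ (τ + 1) r)),
    mul_nonneg (by linarith : 0 ≤ r - 2 * τ) (sq_nonneg (besselJ τ r)),
    mul_nonneg (by linarith : 0 ≤ r - 2 * τ) (sq_nonneg (besselJ (τ + 1) r)),
    mul_nonneg hr0.le (sq_nonneg (besselJ (τ + 1) r))]

theorem exists_abs_besselJ_le {τ : ℝ} (hτ : 0 ≤ τ) :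
    ∃ C, 0 ≤ C ∧ (∀ r, 0 < r → r ≤ 1 → |besselJ τ r| ≤ C * r ^ τ) ∧
      ∀ r, 1 ≤ r → |besselJ τ r| ≤ C * r := by
  obtain ⟨C₁, hC₁⟩ : ∃ C, ∀ y ∈ Set.Icc (0 : ℝ) 1, ‖besselAux τ y‖ ≤ C :=
    isCompact_Icc.exists_bound_of_continuousOn
      fun y _ => (hasDerivAt_besselAux hτ y).continuousAt.continuousWithinAt
  set R : ℝ := 2 * τ + 1
  have hR : 0 < R := by positivity
  obtain ⟨C₂, hC₂⟩ : ∃ C, ∀ r ∈ Set.Icc (1 : ℝ) R, ‖besselJ τ r‖ ≤ C :=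
    isCompact_Icc.exists_bound_of_continuousOn
      ((continuousOn_besselJ hτ).mono fun r hr => zero_lt_one.trans_le hr.1)
  set E : ℝ → ℝ := fun r => (besselJ τ r ^ 2 + besselJ (τ + 1) r ^ 2) / r ^ 2 -
      2 * τ * besselJ τ r * besselJ (τ + 1) r / r ^ 3
  have hE : ∀ r, R ≤ r → |besselJ τ r| ≤ Real.sqrt (2 * |E R|) * r := by
    intro r hr
    have hr0 : 0 < r := hR.trans_le hr
    have hτr : 2 * τ ≤ r := by simp only [R] at hr; linarith
    have h1 : E r ≤ E R :=
      antitoneOn_besselJ_energy hτ hR (by simp [R]) (Set.mem_Ici.2 le_rfl) hr hr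
    have h2 : E r * r ^ 4 = r ^ 2 * (besselJ τ r ^ 2 + besselJ (τ + 1) r ^ 2) -
        2 * τ * r * (besselJ τ r * besselJ (τ + 1) r) := by
      simp only [E]
      field_simp
    have h3 : E r * r ^ 4 ≤ |E R| * r ^ 4 := by
      gcongr
      exact h1.trans (le_abs_self _)
    have h4 : r ^ 2 * besselJ τ r ^ 2 ≤ 2 * (E r * r ^ 4) := by
      rw [h2]
      nlinarith [mul_nonneg (mul_nonneg hτ hr0.le) (sq_nonneg (besselJ τ r - besselJ (τ + 1) r)),
        mul_nonneg (mul_nonneg (by linarith : 0 ≤ r - 2 * τ) hr0.le) (sq_nonneg (besselJ τ r)),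
        mul_nonneg (mul_nonneg (by linarith : 0 ≤ r - 2 * τ) hr0.le)
          (sq_nonneg (besselJ (τ + 1) r)),
        mul_nonneg (mul_nonneg hr0.le hr0.le) (sq_nonneg (besselJ (τ + 1) r))]
    have h5 : r ^ 2 * besselJ τ r ^ 2 ≤ r ^ 2 * (2 * |E R| * r ^ 2) := by linarith
    have h6 := le_of_mul_le_mul_left h5 (by positivity)
    rw [← abs_of_pos hr0, ← abs_of_nonneg (Real.sqrt_nonneg (2 * |E R|)), ← abs_mul]
    refine sq_le_sq.1 ?_
    rwa [mul_pow, Real.sq_sqrt (by positivity), abs_of_pos hr0]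
  have hC₁0 : 0 ≤ C₁ := (norm_nonneg _).trans (hC₁ 0 (by simp))
  have hC₂0 : 0 ≤ C₂ := (norm_nonneg _).trans (hC₂ 1 ⟨le_rfl, by simp [R, hτ]⟩)
  refine ⟨C₁ + C₂ + Real.sqrt (2 * |E R|), by positivity, fun r hr hr1 => ?_, fun r hr => ?_⟩
  · rw [besselJ_eq τ hr, abs_mul, abs_of_nonneg (by positivity), mul_comm]
    gcongr
    · refine (hC₁ _ ⟨by positivity, by nlinarith⟩).trans ?_
      linarith [Real.sqrt_nonneg (2 * |E R|)]
    · linarith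
  · have hs := Real.sqrt_nonneg (2 * |E R|)
    rcases le_total r R with h | h
    · have := hC₂ r ⟨hr, h⟩
      rw [Real.norm_eq_abs] at this
      nlinarith
    · have := hE r h
      nlinarith

theorem exists_abs_besselJ_le_rpow {τ : ℝ} (hτ : 0 ≤ τ) :
    ∃ C, 0 ≤ C ∧ ∀ r, 0 < r → |besselJ τ r| ≤ C * (r ^ τ + r ^ (τ + 1)) := by
  obtain ⟨C, hC, h1, h2⟩ := exists_abs_besselJ_le hτ
  refine ⟨C, hC, fun r hr => ?_⟩
  rcases le_total r 1 with h | h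
  · refine (h1 r hr h).trans ?_
    gcongr
    have := Real.rpow_nonneg hr.le (τ + 1)
    linarith
  · refine (h2 r h).trans ?_
    gcongr
    have h3 : r ^ (1 : ℝ) ≤ r ^ (τ + 1) := Real.rpow_le_rpow_of_exponent_le h (by linarith)
    have h4 := Real.rpow_nonneg hr.le τ
    rw [Real.rpow_one] at h3
    linarith

/-- The integrand `J_τ(r) r^(p-1) x^j e^(-x)` with `x = z r^α`. -/
def besselIntegrand (α τ p : ℝ) (j : ℕ) (z : ℂ) (r : ℝ) : ℂ :=
  ((besselJ τ r * r ^ (p - 1) : ℝ) : ℂ) *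
    ((((r ^ α : ℝ) : ℂ) * z) ^ j * Complex.exp (-(((r ^ α : ℝ) : ℂ) * z)))

theorem norm_besselIntegrand (α τ p : ℝ) (j : ℕ) (z : ℂ) {r : ℝ} (hr : 0 < r) :
    ‖besselIntegrand α τ p j z r‖ =
      |besselJ τ r| * r ^ (p - 1) * ((r ^ α * ‖z‖) ^ j * Real.exp (-(r ^ α * z.re))) := by
  have h1 : 0 ≤ r ^ (p - 1) := by positivity
  have h2 : 0 ≤ r ^ α := by positivity
  rw [besselIntegrand, norm_mul, norm_mul, norm_pow, norm_mul, Complex.norm_exp,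
    Complex.norm_real, Complex.norm_real, Real.norm_eq_abs, Real.norm_eq_abs, abs_mul,
    abs_of_nonneg h1, abs_of_nonneg h2, Complex.neg_re, Complex.re_ofReal_mul]

theorem continuousOn_besselIntegrand (α p : ℝ) {τ : ℝ} (hτ : 0 ≤ τ) (j : ℕ) (z : ℂ) :
    ContinuousOn (besselIntegrand α τ p j z) (Set.Ioi 0) := by
  have h : ∀ q : ℝ, ContinuousOn (fun r : ℝ => r ^ q) (Set.Ioi 0) := fun q =>
    continuousOn_id.rpow_const fun r hr => Or.inl (ne_of_gt hr)
  have h1 : ContinuousOn (fun r : ℝ => ((r ^ α : ℝ) : ℂ) * z) (Set.Ioi 0) :=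
    (Complex.continuous_ofReal.comp_continuousOn (h α)).mul continuousOn_const
  exact (Complex.continuous_ofReal.comp_continuousOn ((continuousOn_besselJ hτ).mul (h _))).mul
    ((h1.pow j).mul (Complex.continuous_exp.comp_continuousOn h1.neg))

theorem aestronglyMeasurable_besselIntegrand (α p : ℝ) {τ : ℝ} (hτ : 0 ≤ τ) (j : ℕ) (z : ℂ) :
    AEStronglyMeasurable (besselIntegrand α τ p j z) (volume.restrict (Set.Ioi 0)) :=
  (continuousOn_besselIntegrand α p hτ j z).aestronglyMeasurable measurableSet_Ioi

theorem integrableOn_besselIntegrand {α τ p : ℝ} (hα : 0 < α) (hτ : 0 ≤ τ) (hp : 0 < p + τ)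
    (j : ℕ) {z : ℂ} (hz : 0 < z.re) :
    IntegrableOn (besselIntegrand α τ p j z) (Set.Ioi 0) := by
  obtain ⟨C, hC, hJ⟩ := exists_abs_besselJ_le_rpow hτ
  have hj : 0 ≤ α * j := by positivity
  have h1 := integrableOn_rpow_mul_exp_neg_mul_rpow
    (s := τ + (p - 1) + α * j) (p := α) (b := z.re) (by linarith) hα hz
  have h2 := integrableOn_rpow_mul_exp_neg_mul_rpow
    (s := τ + 1 + (p - 1) + α * j) (p := α) (b := z.re) (by linarith) hα hz
  refine ((h1.add h2).const_mul (C * ‖z‖ ^ j)).mono'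
    (aestronglyMeasurable_besselIntegrand α p hτ j z) ?_
  filter_upwards [ae_restrict_mem measurableSet_Ioi] with r (hr : 0 < r)
  rw [norm_besselIntegrand α τ p j z hr]
  calc _ ≤ C * (r ^ τ + r ^ (τ + 1)) * r ^ (p - 1) *
        ((r ^ α * ‖z‖) ^ j * Real.exp (-(r ^ α * z.re))) := by
        gcongr
        exact hJ r hr
    _ = _ := by
        simp only [Pi.add_apply, Real.rpow_add hr, Real.rpow_mul hr.le, Real.rpow_natCast,
          Real.rpow_one, mul_pow, neg_mul, mul_comm z.re]
        ring

theorem hasDerivAt_besselIntegrand {α τ p : ℝ} (hτ : 0 ≤ τ) (j : ℕ) (z : ℂ) {r : ℝ} (hr : 0 < r) :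
    HasDerivAt (besselIntegrand α (τ + 1) p j z)
      (besselIntegrand α τ p j z r
        + ((p - τ - 2 + α * j : ℝ) : ℂ) * besselIntegrand α (τ + 1) (p - 1) j z r
        - (α : ℂ) * besselIntegrand α (τ + 1) (p - 1) (j + 1) z r) r := by
  have h1 := ((hasDerivAt_besselJ_add_one hτ hr).mul
    ((hasDerivAt_id r).rpow_const (p := p - 1) (Or.inl hr.ne'))).ofReal_comp
  have h2 : HasDerivAt (fun r : ℝ => ((r ^ α : ℝ) : ℂ) * z) _ r :=
    (((hasDerivAt_id r).rpow_const (p := α) (Or.inl hr.ne')).ofReal_comp).mul_const z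
  have h3 := h1.mul ((h2.pow j).mul h2.neg.cexp)
  refine h3.congr_deriv ?_
  have hr' : (r : ℂ) ≠ 0 := by exact_mod_cast hr.ne'
  have e1 : r ^ (p - 1 - 1) = r ^ (p - 1) / r := Real.rpow_sub_one hr.ne' _
  have e2 : r ^ (α - 1) = r ^ α / r := Real.rpow_sub_one hr.ne' _
  simp only [besselIntegrand, e1, e2, id, Pi.mul_apply, Pi.pow_apply, Pi.neg_apply]
  push_cast
  cases j with
  | zero =>
    simp
    field_simp
    ring
  | succ j =>
    simp
    field_simp
    ring

theorem tendsto_besselIntegrand_nhdsGT_zero {α τ p : ℝ} (hα : 0 < α) (hτ : 0 ≤ τ)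
    (hp : 1 < p + τ) (j : ℕ) (z : ℂ) :
    Tendsto (besselIntegrand α τ p j z) (𝓝[>] 0) (𝓝 0) := by
  obtain ⟨C, hC, hJ⟩ := exists_abs_besselJ_le_rpow hτ
  have hlim : Tendsto (fun r : ℝ => C * (r ^ (τ + p - 1) + r ^ (τ + p)) *
      ((r ^ α * ‖z‖) ^ j * Real.exp (-(r ^ α * z.re)))) (𝓝[>] 0) (𝓝 0) := by
    have hc : ∀ q : ℝ, 0 < q → ContinuousAt (fun r : ℝ => r ^ q) 0 := fun q hq =>
      Real.continuousAt_rpow_const 0 q (Or.inr hq.le)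
    have : ContinuousAt (fun r : ℝ => C * (r ^ (τ + p - 1) + r ^ (τ + p)) *
      ((r ^ α * ‖z‖) ^ j * Real.exp (-(r ^ α * z.re)))) 0 := by
      have a1 := hc (τ + p - 1) (by linarith)
      have a2 := hc (τ + p) (by linarith)
      have a3 := hc α hα
      fun_prop
    have h := this.tendsto
    rw [Real.zero_rpow (by linarith), Real.zero_rpow (by linarith)] at h
    simp only [add_zero, mul_zero, zero_mul] at h
    exact h.mono_left nhdsWithin_le_nhds
  refine squeeze_zero_norm' ?_ hlim
  filter_upwards [self_mem_nhdsWithin] with r (hr : 0 < r)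
  rw [norm_besselIntegrand α τ p j z hr]
  calc _ ≤ C * (r ^ τ + r ^ (τ + 1)) * r ^ (p - 1) *
        ((r ^ α * ‖z‖) ^ j * Real.exp (-(r ^ α * z.re))) := by
        gcongr
        exact hJ r hr
    _ = _ := by
        have e1 : r ^ (τ + p - 1) = r ^ τ * r ^ (p - 1) := by
          rw [← Real.rpow_add hr]
          ring_nf
        have e2 : r ^ (τ + p) = r ^ (τ + 1) * r ^ (p - 1) := by
          rw [← Real.rpow_add hr]
          ring_nf
        rw [e1, e2]
        ring

theorem besselIntegrand_zero_right {α τ p : ℝ} (hτ : 0 < τ) (j : ℕ) (z : ℂ) :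
    besselIntegrand α τ p j z 0 = 0 := by
  have h : besselJ τ 0 = 0 := by
    refine (tsum_congr fun k => ?_).trans tsum_zero
    rw [zero_div, Real.zero_rpow (by positivity), mul_zero, zero_div]
  simp [besselIntegrand, h]

/-- Integration by parts with `(r^(τ+1) J_{τ+1})' = r^(τ+1) J_τ`. -/
theorem integral_besselIntegrand_eq {α τ p : ℝ} (hα : 0 < α) (hτ : 0 ≤ τ) (hp : 0 < p + τ)
    (j : ℕ) {z : ℂ} (hz : 0 < z.re) :
    ∫ r in Set.Ioi (0 : ℝ), besselIntegrand α τ p j z r =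
      ((τ + 2 - p - α * j : ℝ) : ℂ) *
          (∫ r in Set.Ioi (0 : ℝ), besselIntegrand α (τ + 1) (p - 1) j z r)
        + (α : ℂ) * ∫ r in Set.Ioi (0 : ℝ), besselIntegrand α (τ + 1) (p - 1) (j + 1) z r := by
  have hτ1 : 0 ≤ τ + 1 := by positivity
  have i0 := integrableOn_besselIntegrand hα hτ hp j hz
  have i1 := integrableOn_besselIntegrand (p := p - 1) hα hτ1 (by linarith) j hz
  have i2 := integrableOn_besselIntegrand (p := p - 1) hα hτ1 (by linarith) (j + 1) hz
  have i3 := integrableOn_besselIntegrand (p := p) hα hτ1 (by linarith) j hz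
  have i1' := i1.const_mul ((p - τ - 2 + α * j : ℝ) : ℂ)
  have i2' := i2.const_mul (α : ℂ)
  have hd : ∀ r ∈ Set.Ioi (0 : ℝ), HasDerivAt (besselIntegrand α (τ + 1) p j z) _ r :=
    fun r hr => hasDerivAt_besselIntegrand hτ j z hr
  have hi := (i0.add i1').sub i2'
  have hc : ContinuousWithinAt (besselIntegrand α (τ + 1) p j z) (Set.Ici 0) 0 := by
    rw [← continuousWithinAt_Ioi_iff_Ici, ContinuousWithinAt,
      besselIntegrand_zero_right (by positivity)]
    exact tendsto_besselIntegrand_nhdsGT_zero hα hτ1 (by linarith) j z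
  have h := integral_Ioi_of_hasDerivAt_of_tendsto hc hd hi
    (tendsto_zero_of_hasDerivAt_of_integrableOn_Ioi hd hi i3)
  have hs := integral_sub (i0.add i1') i2'
  simp only [Pi.add_apply] at hs
  rw [besselIntegrand_zero_right (by positivity), sub_zero, hs, integral_add i0 i1',
    integral_const_mul, integral_const_mul] at h
  rw [← sub_eq_zero, ← h]
  push_cast
  ring

/-- The sector `{z | 0 < Re z, |z| ≤ C Re z}` in the right half-plane. -/
def rightSector (C : ℝ) : Set ℂ := {z | 0 < z.re ∧ ‖z‖ ≤ C * z.re}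

theorem integrableOn_besselJ_mul_rpow {τ p : ℝ} (hτ : 0 ≤ τ) (hp : 0 < p + τ) (hp1 : p < -1) :
    IntegrableOn (fun r => |besselJ τ r| * r ^ (p - 1)) (Set.Ioi 0) := by
  obtain ⟨C, hC, h1, h2⟩ := exists_abs_besselJ_le hτ
  have hcont : ContinuousOn (fun r => |besselJ τ r| * r ^ (p - 1)) (Set.Ioi 0) :=
    (continuousOn_besselJ hτ).abs.mul
      (continuousOn_id.rpow_const fun r hr => Or.inl (ne_of_gt hr))
  rw [← Set.Ioc_union_Ioi_eq_Ioi (zero_le_one' ℝ)]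
  refine IntegrableOn.union ?_ ?_
  · have h : IntegrableOn (fun r : ℝ => r ^ (τ + (p - 1))) (Set.Ioc 0 1) :=
      (intervalIntegrable_iff_integrableOn_Ioc_of_le zero_le_one).1
        (intervalIntegral.intervalIntegrable_rpow' (by linarith))
    refine (h.const_mul C).mono' ((hcont.mono Set.Ioc_subset_Ioi_self).aestronglyMeasurable
      measurableSet_Ioc) ?_
    filter_upwards [ae_restrict_mem measurableSet_Ioc] with r hr
    have hr0 : 0 < r := hr.1
    rw [Real.norm_of_nonneg (by positivity), Real.rpow_add hr0, ← mul_assoc]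
    gcongr
    exact h1 r hr0 hr.2
  · have h : IntegrableOn (fun r : ℝ => r ^ p) (Set.Ioi 1) :=
      integrableOn_Ioi_rpow_of_lt hp1 one_pos
    refine (h.const_mul C).mono' ((hcont.mono (Set.Ioi_subset_Ioi
      zero_le_one)).aestronglyMeasurable measurableSet_Ioi) ?_
    filter_upwards [ae_restrict_mem measurableSet_Ioi] with r (hr : 1 < r)
    have hr0 : 0 < r := one_pos.trans hr
    have e : r ^ p = r * r ^ (p - 1) := by
      rw [Real.rpow_sub_one hr0.ne']
      field_simp
    rw [Real.norm_of_nonneg (by positivity), e, ← mul_assoc]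
    gcongr
    exact h2 r hr.le

/-- Dominated convergence in the range where `J_τ(r) r^(p-1)` is absolutely integrable. -/
theorem tendsto_integral_besselIntegrand_of_lt {α τ p : ℝ} (hτ : 0 ≤ τ)
    (hp : 0 < p + τ) (hp1 : p < -1) (j : ℕ) {C : ℝ} (hC : 0 ≤ C) :
    Tendsto (fun z => ∫ r in Set.Ioi (0 : ℝ), besselIntegrand α τ p j z r)
      (𝓝[rightSector C] 0) (𝓝 (∫ r in Set.Ioi (0 : ℝ), besselIntegrand α τ p j 0 r)) := by
  refine tendsto_integral_filter_of_dominated_convergence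
    (fun r => |besselJ τ r| * r ^ (p - 1) * (C ^ j * Nat.factorial j))
    (Eventually.of_forall fun z => aestronglyMeasurable_besselIntegrand α p hτ j z) ?_
    ((integrableOn_besselJ_mul_rpow hτ hp hp1).mul_const _) ?_
  · filter_upwards [self_mem_nhdsWithin] with z hz
    filter_upwards [ae_restrict_mem measurableSet_Ioi] with r (hr : 0 < r)
    rw [norm_besselIntegrand α τ p j z hr]
    have hx : 0 ≤ r ^ α * z.re := mul_nonneg (by positivity) hz.1.le
    have h1 : r ^ α * ‖z‖ ≤ C * (r ^ α * z.re) := by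
      calc _ ≤ r ^ α * (C * z.re) := by gcongr; exact hz.2
        _ = _ := by ring
    have h2 : (r ^ α * z.re) ^ j * Real.exp (-(r ^ α * z.re)) ≤ Nat.factorial j := by
      have := Real.pow_div_factorial_le_exp _ hx j
      rw [div_le_iff₀ (by positivity)] at this
      rw [Real.exp_neg, ← div_eq_mul_inv, div_le_iff₀ (Real.exp_pos _)]
      linarith
    have h3 : 0 ≤ r ^ α * ‖z‖ := by positivity
    refine mul_le_mul_of_nonneg_left ?_ (by positivity)
    calc _ ≤ (C * (r ^ α * z.re)) ^ j * Real.exp (-(r ^ α * z.re)) :=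
          mul_le_mul_of_nonneg_right (pow_le_pow_left₀ h3 h1 j) (Real.exp_pos _).le
      _ = C ^ j * ((r ^ α * z.re) ^ j * Real.exp (-(r ^ α * z.re))) := by ring
      _ ≤ _ := by gcongr
  · refine Eventually.of_forall fun r => ?_
    have : Continuous fun z => besselIntegrand α τ p j z r := by
      unfold besselIntegrand
      fun_prop
    exact this.continuousAt.tendsto.mono_left nhdsWithin_le_nhds

/-- The Mellin transform of `J_τ`. -/
def besselMellin (τ p : ℝ) : ℝ :=
  2 ^ (p - 1) * Real.Gamma ((τ + p) / 2) / Real.Gamma (1 + (τ - p) / 2)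

theorem besselMellin_eq (τ p : ℝ) :
    besselMellin τ p = (τ + 2 - p) * besselMellin (τ + 1) (p - 1) := by
  have h : (Real.Gamma (1 + (τ - p) / 2))⁻¹ =
      (1 + (τ - p) / 2) * (Real.Gamma (1 + (τ - p) / 2 + 1))⁻¹ := by
    rcases eq_or_ne (1 + (τ - p) / 2) 0 with h | h
    · simp [h]
    · rw [Real.Gamma_add_one h, mul_inv, mul_inv_cancel_left₀ h]
  simp only [besselMellin, div_eq_mul_inv _ (Real.Gamma _)]
  rw [h, Real.rpow_sub_one two_ne_zero (p - 1)]
  ring_nf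

theorem tendsto_pow_mul_integral_exp_neg {a c : ℝ} (ha : 0 < a) (hc : 1 ≤ c) :
    Tendsto (fun x : ℝ => x ^ a * ∫ t in Set.Ioc (0 : ℝ) 1,
      Real.exp (-(x * t)) * (t ^ (a - 1) * (1 - t) ^ (c - 1))) atTop (𝓝 (Real.Gamma a)) := by
  have h : Tendsto (fun x : ℝ => ∫ u in Set.Ioi (0 : ℝ), (Set.Ioc 0 x).indicator
      (fun u => Real.exp (-u) * u ^ (a - 1) * (1 - u / x) ^ (c - 1)) u) atTop
      (𝓝 (Real.Gamma a)) := by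
    rw [Real.Gamma_eq_integral ha]
    refine tendsto_integral_filter_of_dominated_convergence
      (fun u => Real.exp (-u) * u ^ (a - 1)) ?_ ?_ (Real.GammaIntegral_convergent ha) ?_
    · refine Eventually.of_forall fun x => ?_
      refine (Measurable.indicator ?_ measurableSet_Ioc).aestronglyMeasurable
      fun_prop
    · filter_upwards [eventually_gt_atTop 0] with x hx
      filter_upwards [ae_restrict_mem measurableSet_Ioi] with u (hu : 0 < u)
      by_cases hux : u ∈ Set.Ioc 0 x
      · have h0 : 0 ≤ 1 - u / x := by
          rw [sub_nonneg, div_le_one hx]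
          exact hux.2
        rw [Set.indicator_of_mem hux, Real.norm_of_nonneg (by positivity)]
        refine mul_le_of_le_one_right (by positivity) (Real.rpow_le_one h0 ?_ (by linarith))
        have : 0 ≤ u / x := by positivity
        linarith
      · rw [Set.indicator_of_notMem hux, norm_zero]
        positivity
    · filter_upwards [ae_restrict_mem measurableSet_Ioi] with u (hu : 0 < u)
      have h1 : Tendsto (fun x : ℝ => (1 - u / x) ^ (c - 1)) atTop (𝓝 ((1 - 0) ^ (c - 1))) :=
        ((tendsto_const_nhds (x := (1:ℝ))).sub (tendsto_const_nhds.div_atTop tendsto_id)).rpow_const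
          (Or.inr (by linarith))
      rw [sub_zero, Real.one_rpow] at h1
      have h2 := h1.const_mul (Real.exp (-u) * u ^ (a - 1))
      rw [mul_one] at h2
      refine h2.congr' ?_
      filter_upwards [eventually_ge_atTop u] with x hx
      rw [Set.indicator_of_mem (Set.mem_Ioc.2 ⟨hu, hx⟩)]
  refine h.congr' ?_
  filter_upwards [eventually_gt_atTop 0] with x hx
  rw [setIntegral_indicator measurableSet_Ioc, Set.inter_eq_right.2 Set.Ioc_subset_Ioi_self,
    ← intervalIntegral.integral_of_le hx.le, ← intervalIntegral.integral_of_le zero_le_one]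
  have hs := intervalIntegral.integral_comp_mul_left (a := 0) (b := 1)
    (fun u => Real.exp (-u) * u ^ (a - 1) * (1 - u / x) ^ (c - 1)) hx.ne'
  rw [mul_zero, mul_one, eq_inv_smul_iff₀ hx.ne', smul_eq_mul] at hs
  rw [← hs, ← intervalIntegral.integral_const_mul, ← intervalIntegral.integral_const_mul]
  refine intervalIntegral.integral_congr fun t ht => ?_
  rw [Set.uIcc_of_le zero_le_one] at ht
  have e : x ^ a = x * x ^ (a - 1) := by
    rw [Real.rpow_sub_one hx.ne']
    field_simp
  simp only [Real.mul_rpow hx.le ht.1, mul_div_cancel_left₀ t hx.ne', e]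
  ring

theorem ofReal_betaIntegrand {a c t : ℝ} (ht : t ∈ Set.Ioc (0 : ℝ) 1) :
    (t : ℂ) ^ ((a : ℂ) - 1) * (1 - (t : ℂ)) ^ ((c : ℂ) - 1) =
      ((t ^ (a - 1) * (1 - t) ^ (c - 1) : ℝ) : ℂ) := by
  rw [Complex.ofReal_mul, Complex.ofReal_cpow ht.1.le, Complex.ofReal_cpow (sub_nonneg.2 ht.2)]
  push_cast
  rfl

theorem integrableOn_rpow_mul_one_sub_rpow {a c : ℝ} (ha : 0 < a) (hc : 0 < c) :
    IntegrableOn (fun t : ℝ => t ^ (a - 1) * (1 - t) ^ (c - 1)) (Set.Ioc 0 1) := by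
  have h := (intervalIntegrable_iff_integrableOn_Ioc_of_le zero_le_one).1
    (Complex.betaIntegral_convergent (u := a) (v := c) (by simpa) (by simpa))
  have h2 := h.congr_fun (fun t ht => ofReal_betaIntegrand ht) measurableSet_Ioc
  simpa only [IntegrableOn, RCLike.re_to_complex, Complex.ofReal_re] using h2.re

theorem integral_rpow_mul_one_sub_rpow {a c : ℝ} (ha : 0 < a) (hc : 0 < c) :
    ∫ t in Set.Ioc (0 : ℝ) 1, t ^ (a - 1) * (1 - t) ^ (c - 1) =
      Real.Gamma a * Real.Gamma c / Real.Gamma (a + c) := by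
  have h := ProbabilityTheory.beta_eq_betaIntegralReal a c ha hc
  rw [ProbabilityTheory.beta, Complex.betaIntegral,
    intervalIntegral.integral_of_le zero_le_one,
    setIntegral_congr_fun measurableSet_Ioc fun t ht => ofReal_betaIntegrand ht,
    integral_complex_ofReal, Complex.ofReal_re] at h
  exact h.symm

theorem summable_pow_div_factorial_mul_Gamma {a c x : ℝ} (ha : 0 < a) (hc : 0 < c) (hx : 0 ≤ x) :
    Summable fun k : ℕ => x ^ k / Nat.factorial k *
      (Real.Gamma (k + a) * Real.Gamma c / Real.Gamma (k + a + c)) := by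
  refine Summable.of_nonneg_of_le (fun k => ?_) (fun k => ?_)
    ((Real.summable_pow_div_factorial x).mul_right
      (Real.Gamma a * Real.Gamma c / Real.Gamma (a + c)))
  · have h1 : 0 < Real.Gamma (k + a) := Real.Gamma_pos_of_pos (by positivity)
    have h2 : 0 < Real.Gamma (k + a + c) := Real.Gamma_pos_of_pos (by positivity)
    have h3 : 0 < Real.Gamma c := Real.Gamma_pos_of_pos hc
    positivity
  · have hk : (0 : ℝ) < k + a := by positivity
    refine mul_le_mul_of_nonneg_left ?_ (by positivity)
    rw [← integral_rpow_mul_one_sub_rpow ha hc, ← integral_rpow_mul_one_sub_rpow hk hc]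
    refine setIntegral_mono_on (integrableOn_rpow_mul_one_sub_rpow hk hc)
      (integrableOn_rpow_mul_one_sub_rpow ha hc) measurableSet_Ioc fun t ht => ?_
    have h1 : 0 ≤ 1 - t := sub_nonneg.2 ht.2
    refine mul_le_mul_of_nonneg_right ?_ (by positivity)
    refine Real.rpow_le_rpow_of_exponent_ge ht.1 ht.2 ?_
    have : (0 : ℝ) ≤ k := k.cast_nonneg
    linarith

/-- The power series of the confluent hypergeometric function through its Euler integral. -/
theorem hasSum_integral_exp_neg_mul {a c x : ℝ} (ha : 0 < a) (hc : 0 < c) (hx : 0 ≤ x) :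
    HasSum (fun k : ℕ => (-1) ^ k * (x ^ k / Nat.factorial k *
        (Real.Gamma (k + a) * Real.Gamma c / Real.Gamma (k + a + c))))
      (∫ t in Set.Ioc (0 : ℝ) 1,
        Real.exp (-(x * t)) * (t ^ (a - 1) * (1 - t) ^ (c - 1))) := by
  set F : ℕ → ℝ → ℝ := fun k t => (-1) ^ k * (x ^ k / Nat.factorial k) *
    (t ^ ((k : ℝ) + a - 1) * (1 - t) ^ (c - 1))
  have hk : ∀ k : ℕ, (0 : ℝ) < k + a := fun k => by positivity
  have hF : ∀ k, Integrable (F k) (volume.restrict (Set.Ioc 0 1)) := fun k =>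
    (integrableOn_rpow_mul_one_sub_rpow (hk k) hc).const_mul _
  have hI : ∀ k, ∫ t in Set.Ioc (0 : ℝ) 1, F k t = (-1) ^ k * (x ^ k / Nat.factorial k *
      (Real.Gamma (k + a) * Real.Gamma c / Real.Gamma (k + a + c))) := fun k => by
    rw [integral_const_mul, integral_rpow_mul_one_sub_rpow (hk k) hc, mul_assoc]
  have hN : ∀ k, ∫ t in Set.Ioc (0 : ℝ) 1, ‖F k t‖ = x ^ k / Nat.factorial k *
      (Real.Gamma (k + a) * Real.Gamma c / Real.Gamma (k + a + c)) := fun k => by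
    rw [← integral_rpow_mul_one_sub_rpow (hk k) hc, ← integral_const_mul]
    refine setIntegral_congr_fun measurableSet_Ioc fun t ht => ?_
    have h0 : 0 ≤ t := ht.1.le
    have h1 : 0 ≤ 1 - t := sub_nonneg.2 ht.2
    simp only [F]
    rw [norm_mul, norm_mul, norm_pow, norm_neg, norm_one, one_pow, one_mul,
      Real.norm_of_nonneg (by positivity), Real.norm_of_nonneg (by positivity)]
  have h := hasSum_integral_of_summable_integral_norm hF
    (by simp only [hN]; exact summable_pow_div_factorial_mul_Gamma ha hc hx)
  simp only [hI] at h
  suffices hs : ∀ t ∈ Set.Ioc (0 : ℝ) 1,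
      Real.exp (-(x * t)) * (t ^ (a - 1) * (1 - t) ^ (c - 1)) = ∑' k, F k t by
    rwa [setIntegral_congr_fun measurableSet_Ioc hs]
  intro t ht
  have e : Real.exp (-(x * t)) = ∑' k : ℕ, (-(x * t)) ^ k / Nat.factorial k := by
    rw [Real.exp_eq_exp_ℝ, NormedSpace.exp_eq_tsum_div]
  simp only [e, F]
  rw [← tsum_mul_right]
  refine tsum_congr fun k => ?_
  rw [add_sub_assoc, Real.rpow_add ht.1, Real.rpow_natCast, neg_pow, mul_pow]
  ring

theorem integral_besselJ_mul_exp_neg_sq {τ p x : ℝ} (hτ : 0 ≤ τ) (hp : 0 < p + τ) (hpτ : p ≤ τ)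
    (hx : 0 < x) :
    ∫ r in Set.Ioi (0 : ℝ), besselJ τ r * r ^ (p - 1) * Real.exp (-(4 * x)⁻¹ * r ^ (2 : ℝ)) =
      2 ^ (p - 1) / Real.Gamma (1 + (τ - p) / 2) * (x ^ ((τ + p) / 2) *
        ∫ t in Set.Ioc (0 : ℝ) 1, Real.exp (-(x * t)) *
          (t ^ ((τ + p) / 2 - 1) * (1 - t) ^ (1 + (τ - p) / 2 - 1))) := by
  set a := (τ + p) / 2 with ha_def
  set c := 1 + (τ - p) / 2 with hc_def
  have ha : 0 < a := by simp only [a]; linarith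
  have hc : 0 < c := by simp only [c]; linarith
  have hac : a + c = τ + 1 := by simp only [a, c]; ring
  have hΓc : 0 < Real.Gamma c := Real.Gamma_pos_of_pos hc
  set A : ℕ → ℝ := fun k =>
    (2 ^ (2 * (k : ℝ) + τ) * (Nat.factorial k * Real.Gamma ((k : ℝ) + τ + 1)))⁻¹ with hA
  set g : ℕ → ℝ → ℝ := fun k r => r ^ (2 * (k : ℝ) + τ + (p - 1)) *
    Real.exp (-(4 * x)⁻¹ * r ^ (2 : ℝ))
  have hexp : ∀ k : ℕ, -1 < 2 * (k : ℝ) + τ + (p - 1) := fun k => by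
    have : (0 : ℝ) ≤ k := k.cast_nonneg
    linarith
  have hb : 0 < (4 * x)⁻¹ := by positivity
  have hA0 : ∀ k, 0 ≤ A k := fun k => by
    have : 0 < Real.Gamma ((k : ℝ) + τ + 1) := Real.Gamma_pos_of_pos (by positivity)
    positivity
  have hg : ∀ k, IntegrableOn (g k) (Set.Ioi 0) := fun k =>
    integrableOn_rpow_mul_exp_neg_mul_rpow (hexp k) two_pos hb
  have hI : ∀ k, A k * ∫ r in Set.Ioi (0 : ℝ), g k r =
      2 ^ (p - 1) / Real.Gamma c * x ^ a * (x ^ k / Nat.factorial k *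
        (Real.Gamma (k + a) * Real.Gamma c / Real.Gamma (k + a + c))) := fun k => by
    have hΓ : 0 < Real.Gamma ((k : ℝ) + τ + 1) := Real.Gamma_pos_of_pos (by positivity)
    simp only [g]
    rw [integral_rpow_mul_exp_neg_mul_rpow two_pos (hexp k) hb]
    have e1 : (2 * (k : ℝ) + τ + (p - 1) + 1) / 2 = k + a := by simp only [a]; ring
    have e2 : -(2 * (k : ℝ) + τ + (p - 1) + 1) / 2 = -(k + a) := by simp only [a]; ring
    have e3 : ((4 * x)⁻¹) ^ (-((k : ℝ) + a)) = 4 ^ ((k : ℝ) + a) * (x ^ a * x ^ k) := by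
      rw [Real.inv_rpow (by positivity), Real.rpow_neg (by positivity), inv_inv,
        Real.mul_rpow (by norm_num) hx.le, Real.rpow_add hx, Real.rpow_natCast, mul_comm (x ^ k)]
    have e4 : (4 : ℝ) ^ ((k : ℝ) + a) = 2 ^ (2 * (k : ℝ) + τ) * 2 ^ (p - 1) * 2 := by
      rw [show (4 : ℝ) = 2 ^ (2 : ℝ) by norm_num, ← Real.rpow_mul (by norm_num),
        ← Real.rpow_add two_pos, ← Real.rpow_add_one two_ne_zero]
      congr 1
      simp only [a]
      ring
    rw [e1, e2, e3, e4, add_assoc (k : ℝ) a c, hac, ← add_assoc (k : ℝ) τ 1]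
    simp only [hA]
    have : (0 : ℝ) < 2 ^ (2 * (k : ℝ) + τ) := by positivity
    field_simp
  have hN : ∀ k, ∫ r in Set.Ioi (0 : ℝ), ‖(-1) ^ k * A k * g k r‖ =
      A k * ∫ r in Set.Ioi (0 : ℝ), g k r := fun k => by
    rw [← integral_const_mul]
    refine setIntegral_congr_fun measurableSet_Ioi fun r (hr : 0 < r) => ?_
    have h0 : 0 ≤ g k r := by positivity
    rw [norm_mul, norm_mul, norm_pow, norm_neg, norm_one, one_pow, one_mul,
      Real.norm_of_nonneg (hA0 k), Real.norm_of_nonneg h0]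
  have h1 := hasSum_integral_of_summable_integral_norm (F := fun k r => (-1) ^ k * A k * g k r)
    (μ := volume.restrict (Set.Ioi 0)) (fun k => (hg k).const_mul _)
    (by
      simp only [hN, hI]
      exact (summable_pow_div_factorial_mul_Gamma ha hc hx.le).mul_left _)
  have h2 := (hasSum_integral_exp_neg_mul ha hc hx.le).mul_left
    (2 ^ (p - 1) / Real.Gamma c * x ^ a)
  have h3 : ∀ k, ∫ r in Set.Ioi (0 : ℝ), (-1) ^ k * A k * g k r =
      2 ^ (p - 1) / Real.Gamma c * x ^ a * ((-1) ^ k * (x ^ k / Nat.factorial k *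
        (Real.Gamma (k + a) * Real.Gamma c / Real.Gamma (k + a + c)))) := fun k => by
    rw [integral_const_mul, mul_assoc, hI]
    ring
  simp only [h3] at h1
  rw [← mul_assoc, ← h1.unique h2]
  refine setIntegral_congr_fun measurableSet_Ioi fun r (hr : 0 < r) => ?_
  simp only [besselJ]
  rw [mul_assoc, ← tsum_mul_right]
  refine tsum_congr fun k => ?_
  simp only [hA, g]
  rw [Real.div_rpow hr.le two_pos.le, Real.rpow_add hr (2 * (k : ℝ) + τ)]
  field_simp

theorem integral_besselJ_mul_rpow {τ p : ℝ} (hτ : 0 ≤ τ) (hp : 0 < p + τ) (hp1 : p < -1) :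
    ∫ r in Set.Ioi (0 : ℝ), besselJ τ r * r ^ (p - 1) = besselMellin τ p := by
  have ha : 0 < (τ + p) / 2 := by linarith
  have hc : 1 ≤ 1 + (τ - p) / 2 := by linarith
  have h1 := (tendsto_pow_mul_integral_exp_neg ha hc).const_mul
    (2 ^ (p - 1) / Real.Gamma (1 + (τ - p) / 2))
  have hx : Tendsto (fun x : ℝ => (((4 * x)⁻¹ : ℝ) : ℂ)) atTop (𝓝[rightSector 1] 0) := by
    rw [tendsto_nhdsWithin_iff]
    constructor
    · have : Tendsto (fun x : ℝ => (4 * x)⁻¹) atTop (𝓝 0) :=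
        tendsto_inv_atTop_zero.comp (tendsto_id.const_mul_atTop (by norm_num))
      have h := (Complex.continuous_ofReal.tendsto 0).comp this
      rwa [Complex.ofReal_zero] at h
    · filter_upwards [eventually_gt_atTop 0] with x hx
      have : 0 < (4 * x)⁻¹ := by positivity
      refine ⟨by simpa only [Complex.ofReal_re], ?_⟩
      rw [Complex.norm_real, Complex.ofReal_re, one_mul, Real.norm_of_nonneg this.le]
  have h2 := (tendsto_integral_besselIntegrand_of_lt (α := 2) hτ hp hp1 0 zero_le_one).comp hx
  have h3 : ∀ r : ℝ, besselIntegrand 2 τ p 0 0 r = ((besselJ τ r * r ^ (p - 1) : ℝ) : ℂ) := by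
    simp [besselIntegrand]
  simp only [h3, integral_complex_ofReal] at h2
  have h4 := (Complex.continuous_re.tendsto _).comp h2
  rw [Complex.ofReal_re] at h4
  refine tendsto_nhds_unique h4 ?_
  have e : besselMellin τ p = 2 ^ (p - 1) / Real.Gamma (1 + (τ - p) / 2) *
      Real.Gamma ((τ + p) / 2) := by
    rw [besselMellin]
    ring
  rw [e]
  refine h1.congr' ?_
  filter_upwards [eventually_gt_atTop 0] with x hx
  rw [← integral_besselJ_mul_exp_neg_sq hτ hp (by linarith) hx]
  simp only [Function.comp_apply, besselIntegrand, pow_zero, one_mul]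
  rw [← Complex.ofReal_re (∫ r in Set.Ioi (0 : ℝ), _), ← integral_complex_ofReal]
  congr 2
  ext r
  push_cast
  ring_nf

/-- Abel summability of the Mellin transform of `J_τ`, by induction on the number of integrations
by parts that are needed to reach the absolutely convergent range. -/
theorem tendsto_integral_besselIntegrand {α : ℝ} (hα : 0 < α) {C : ℝ} (hC : 0 ≤ C) (n : ℕ) :
    ∀ {τ p : ℝ}, 0 ≤ τ → 0 < p + τ → p < -1 + n → ∀ j : ℕ,
    Tendsto (fun z => ∫ r in Set.Ioi (0 : ℝ), besselIntegrand α τ p j z r)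
      (𝓝[rightSector C] 0) (𝓝 (if j = 0 then (besselMellin τ p : ℂ) else 0)) := by
  induction n with
  | zero =>
    intro τ p hτ hp hpn j
    have hp1 : p < -1 := by simpa using hpn
    convert tendsto_integral_besselIntegrand_of_lt (α := α) hτ hp hp1 j hC using 2
    split_ifs with hj
    · rw [← integral_besselJ_mul_rpow hτ hp hp1, ← integral_complex_ofReal]
      simp [besselIntegrand, hj]
    · simp [besselIntegrand, hj]
  | succ n ih =>
    intro τ p hτ hp hpn j
    have hpn' : p - 1 < -1 + n := by
      push_cast at hpn
      linarith
    have hτ1 : 0 ≤ τ + 1 := by positivity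
    have h := ((ih hτ1 (by linarith) hpn' j).const_mul ((τ + 2 - p - α * j : ℝ) : ℂ)).add
      ((ih hτ1 (by linarith) hpn' (j + 1)).const_mul (α : ℂ))
    have e : ((τ + 2 - p - α * j : ℝ) : ℂ) *
        (if j = 0 then (besselMellin (τ + 1) (p - 1) : ℂ) else 0) +
        (α : ℂ) * (if j + 1 = 0 then (besselMellin (τ + 1) (p - 1) : ℂ) else 0) =
        if j = 0 then (besselMellin τ p : ℂ) else 0 := by
      rcases eq_or_ne j 0 with rfl | hj
      · simp [besselMellin_eq τ p]
      · simp [hj]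
    rw [e] at h
    refine h.congr' ?_
    filter_upwards [self_mem_nhdsWithin] with z hz
    exact (integral_besselIntegrand_eq hα hτ hp j hz.1).symm

theorem exists_subset_rightSector {K : Set ℂ} (hK : K ⊆ {z : ℂ | 0 < z.re}) (hc : IsCompact K) :
    ∃ C, 0 ≤ C ∧ K ⊆ rightSector C := by
  have hcont : ContinuousOn (fun z : ℂ => ‖z‖ / z.re) K :=
    continuous_norm.continuousOn.div Complex.continuous_re.continuousOn
      fun z hz => (hK hz).ne'
  obtain ⟨C, hC⟩ := hc.exists_bound_of_continuousOn hcont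
  refine ⟨max C 0, le_max_right _ _, fun z hz => ?_⟩
  have h0 : 0 < z.re := hK hz
  refine ⟨h0, ?_⟩
  rw [← div_le_iff₀ h0]
  exact (le_abs_self _).trans ((hC z hz).trans (le_max_left _ _))

/-- Lemma: for `α ∈ (1,2)`, `τ > 0`, `p > 0`,
`f_s(ξ) = ∫_0^∞ J_τ(r) r^{p-1} e^{-s r^α ξ} dr → 2^{p-1} Γ((τ+p)/2)/Γ(1+(τ-p)/2)`
as `s → 0+`, uniformly on compact subsets of `{Re ξ > 0}`. -/
theorem stmt19 (α : ℝ) (hα1 : 1 < α) (hα2 : α < 2) (τ : ℝ) (hτ : 0 < τ)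
    (p : ℝ) (hp : 0 < p) :
    ∀ K : Set ℂ, K ⊆ {z : ℂ | 0 < z.re} → IsCompact K →
      TendstoUniformlyOn
        (fun (s : ℝ) (ξ : ℂ) =>
          ∫ r in Set.Ioi (0 : ℝ),
            ((besselJ τ r * r ^ (p - 1) : ℝ) : ℂ) *
              Complex.exp (-(((s * r ^ α : ℝ) : ℂ) * ξ)))
        (fun _ : ℂ =>
          (((2 : ℝ) ^ (p - 1) * Real.Gamma ((τ + p) / 2) /
            Real.Gamma (1 + (τ - p) / 2) : ℝ) : ℂ))
        (nhdsWithin (0 : ℝ) (Set.Ioi 0)) K := by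
  intro K hK hKc
  obtain ⟨C, hC, hKC⟩ := exists_subset_rightSector hK hKc
  obtain ⟨B, hB⟩ := hKc.exists_bound_of_continuousOn continuousOn_id
  obtain ⟨n, hn⟩ := exists_nat_gt (p + 1)
  have h := tendsto_integral_besselIntegrand (by linarith : 0 < α) hC n hτ.le
    (by linarith : 0 < p + τ) (by linarith) 0
  rw [if_pos rfl] at h
  rw [← tendsto_prod_principal_iff]
  have hmem : ∀ᶠ q : ℝ × ℂ in 𝓝[>] (0 : ℝ) ×ˢ 𝓟 K, 0 < q.1 ∧ q.2 ∈ K :=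
    (eventually_mem_nhdsWithin (s := Set.Ioi (0 : ℝ))).prod_mk
      (eventually_principal.2 fun _ hx => hx)
  have hz : Tendsto (fun q : ℝ × ℂ => (q.1 : ℂ) * q.2) (𝓝[>] (0 : ℝ) ×ˢ 𝓟 K)
      (𝓝[rightSector C] 0) := by
    rw [tendsto_nhdsWithin_iff]
    constructor
    · have h1 : Tendsto (fun q : ℝ × ℂ => |q.1| * B) (𝓝[>] (0 : ℝ) ×ˢ 𝓟 K) (𝓝 0) := by
        have h2 : Tendsto (fun s : ℝ => |s| * B) (𝓝[>] 0) (𝓝 0) := by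
          have : Continuous fun s : ℝ => |s| * B := by fun_prop
          simpa using (this.tendsto 0).mono_left nhdsWithin_le_nhds
        exact h2.comp tendsto_fst
      refine squeeze_zero_norm' ?_ h1
      filter_upwards [hmem] with q hq
      rw [norm_mul, Complex.norm_real, Real.norm_eq_abs]
      gcongr
      exact hB _ hq.2
    · filter_upwards [hmem] with q hq
      obtain ⟨h1, h2⟩ := hKC hq.2
      refine ⟨?_, ?_⟩
      · rw [Complex.re_ofReal_mul]
        exact mul_pos hq.1 h1
      · rw [Complex.re_ofReal_mul, norm_mul, Complex.norm_real, Real.norm_of_nonneg hq.1.le]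
        nlinarith [hq.1]
  refine (h.comp hz).congr fun q => ?_
  simp only [Function.comp_apply, besselIntegrand, pow_zero, one_mul, Function.HasUncurry.uncurry,
    id]
  congr 1
  ext r
  push_cast
  ring_nf

end StablePaper
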